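/- arXiv:0906.3749 — 2 statements merged into one kernel-verified Lean document; each statement's English description precedes it below -/
import Mathlib

section
/- In Rado's busy beaver model, every Turing machine with 2 states and 2 symbols that halts when started in state A on the all-blank tape performs at most 6 steps and leaves at most 4 non-blank cells, and both bounds are attained by some such machine; that is, S(2,2) = 6 and Σ(2,2) = 4. -/
/-- Move direction of the tape head. -/
inductive Dir : Type
  | L
  | R

/-- The head displacement of a direction. -/
def Dir.move : Dir → ℤ
  | Dir.L => -1
  | Dir.R => 1

/-- A Turing machine with `n` states and `k` symbols, in Rado's busy beaver model.
States are `Fin n` (state `A` is `0`, `B` is `1`, ...), symbols are `Fin k` with `0`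
the blank symbol. A transition yields the written symbol, the move direction and the
next state, where `none` denotes the halting state `H`. -/
abbrev Machine (n k : ℕ) : Type :=
  Fin n → Fin k → Fin k × Dir × Option (Fin n)

/-- A configuration: current state (`none` = halted), head position, tape. -/
structure Cfg (n k : ℕ) where
  state : Option (Fin n)
  pos : ℤ
  tape : ℤ → Fin k

/-- One computation step (halted configurations are fixed). -/
def step {n k : ℕ} (M : Machine n k) (c : Cfg n k) : Cfg n k :=
  match c.state with
  | none => c
  | some q =>
      { state := (M q (c.tape c.pos)).2.2
        pos := c.pos + (M q (c.tape c.pos)).2.1.move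
        tape := Function.update c.tape c.pos (M q (c.tape c.pos)).1 }

/-- The initial configuration: state `A`, head at cell `0`, all-blank tape. -/
def init (n k : ℕ) [NeZero k] : Cfg n k :=
  { state := if h : 0 < n then some ⟨0, h⟩ else none
    pos := 0
    tape := fun _ => 0 }

/-- `HaltsIn M c t`: started from `c`, the machine `M` halts after exactly `t` steps. -/
def HaltsIn {n k : ℕ} (M : Machine n k) (c : Cfg n k) (t : ℕ) : Prop :=
  ((step M)^[t] c).state = none ∧ ∀ i < t, ((step M)^[i] c).state ≠ none

/-- The number of non-blank cells of a configuration. -/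
noncomputable def sigmaCount {n k : ℕ} [NeZero k] (c : Cfg n k) : ℕ :=
  Set.ncard {i : ℤ | c.tape i ≠ 0}

/-- Rado's condition: every transition into the halting state writes `1` and moves right. -/
def Valid {n k : ℕ} [NeZero k] (M : Machine n k) : Prop :=
  ∀ q a, (M q a).2.2 = none → (M q a).1 = 1 ∧ (M q a).2.1 = Dir.R

/-- The busy beaver step function `S(n,k)`: the maximum number of steps of a halting
`n`-state `k`-symbol machine started on the all-blank tape. -/
noncomputable def bbS (n k : ℕ) [NeZero k] : ℕ :=
  sSup {t : ℕ | ∃ M : Machine n k, Valid M ∧ HaltsIn M (init n k) t}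

/-- The busy beaver score function `Σ(n,k)`: the maximum number of non-blank cells left
by a halting `n`-state `k`-symbol machine started on the all-blank tape. -/
noncomputable def bbSigma (n k : ℕ) [NeZero k] : ℕ :=
  sSup {m : ℕ | ∃ M : Machine n k, Valid M ∧
    ∃ t : ℕ, HaltsIn M (init n k) t ∧ sigmaCount ((step M)^[t] (init n k)) = m}

/-- A non-halting transition: written symbol, direction, next state. -/
abbrev Rule : Type := Fin 2 × Dir × Fin 2

/-- A partially specified 2-state 2-symbol machine, all of whose known transitions are
non-halting. -/
abbrev Table : Type := Fin 2 → Fin 2 → Option Rule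

namespace Table

/-- The machine `M` has all the transitions prescribed by the table `P`. -/
def Agrees (P : Table) (M : Machine 2 2) : Prop :=
  ∀ q a w d q', P q a = some (w, d, q') → M q a = (w, d, some q')

/-- Prescribe one more transition. -/
def define (P : Table) (q a : Fin 2) (r : Rule) : Table :=
  Function.update P q (Function.update (P q) a (some r))

lemma Agrees.define {P : Table} {M : Machine 2 2} (h : P.Agrees M) {q a w q' : Fin 2} {d : Dir}
    (hM : M q a = (w, d, some q')) : (P.define q a (w, d, q')).Agrees M := by
  intro r b w' d' r' hr
  by_cases hq : r = q
  · subst hq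
    by_cases ha : b = a
    · subst ha
      simp only [Table.define, Function.update_self, Option.some.injEq, Prod.mk.injEq] at hr
      obtain ⟨rfl, rfl, rfl⟩ := hr
      exact hM
    · simp only [Table.define, Function.update_self, Function.update_of_ne ha] at hr
      exact h _ _ _ _ _ hr
  · simp only [Table.define, Function.update_of_ne hq] at hr
    exact h _ _ _ _ _ hr

end Table

/-- The neighbourhood of the head: state, symbol to the left, scanned symbol, symbol to the
right. -/
abbrev Window : Type := Fin 2 × Fin 2 × Fin 2 × Fin 2

/-- A set of windows, together with sets of symbols allowed to the left and to the right of
the window. -/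
structure Region where
  windows : List Window
  left : List (Fin 2)
  right : List (Fin 2)

namespace Region

/-- The region meant to describe only the initial configuration. -/
def start : Region := ⟨[(0, 0, 0, 0)], [0], [0]⟩

/-- The componentwise union of two regions. -/
def union (A B : Region) : Region :=
  ⟨A.windows ∪ B.windows, A.left ∪ B.left, A.right ∪ B.right⟩

/-- What a region `A` containing the window `v` has to contain in order to be closed under the
transition of `P` at `v`, if there is one. -/
def post (A : Region) (P : Table) (v : Window) : Option Region :=
  match P v.1 v.2.2.1 with
  | none => none
  | some (w, Dir.L, q) => some ⟨A.left.map fun x => (q, x, v.2.1, w), [], [v.2.2.2]⟩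
  | some (w, Dir.R, q) => some ⟨A.right.map fun x => (q, w, v.2.2.2, x), [v.2.1], []⟩

/-- Add to a region everything required by its windows. -/
def extend (A : Region) (P : Table) : Region :=
  A.windows.foldl (fun B v => (A.post P v).elim B B.union) A

/-- Every window of the region has a transition in `P`, which does not leave the region. -/
def closed (A : Region) (P : Table) : Bool :=
  A.windows.all fun v => (A.post P v).elim false fun B =>
    decide (B.windows ⊆ A.windows ∧ B.left ⊆ A.left ∧ B.right ⊆ A.right)

/-- The configuration is described by the region. -/
structure Covers (A : Region) (c : Cfg 2 2) : Prop where
  window : ∃ q, c.state = some q ∧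
    (q, c.tape (c.pos - 1), c.tape c.pos, c.tape (c.pos + 1)) ∈ A.windows
  left : ∀ i < c.pos - 1, c.tape i ∈ A.left
  right : ∀ i > c.pos + 1, c.tape i ∈ A.right

lemma Covers.step {A : Region} {P : Table} {M : Machine 2 2} {c : Cfg 2 2}
    (hA : A.closed P = true) (hM : P.Agrees M) (hc : A.Covers c) : A.Covers (step M c) := by
  obtain ⟨⟨q, hq, hw⟩, hl, hr⟩ := hc
  obtain ⟨s, p, f⟩ := c
  dsimp only at hq hw hl hr
  subst hq
  have h := List.all_eq_true.mp hA _ hw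
  unfold post at h
  dsimp only at h
  split at h
  · simp at h
  · rename_i w q' hP
    simp only [Option.elim_some, decide_eq_true_eq, List.cons_subset, List.nil_subset,
      and_true, true_and] at h
    obtain ⟨h1, h2⟩ := h
    have hMq := hM _ _ _ _ _ hP
    refine ⟨⟨q', ?_, ?_⟩, ?_, ?_⟩ <;> simp only [_root_.step, hMq, Dir.move]
    · apply h1
      rw [List.mem_map]
      refine ⟨f (p - 1 - 1), hl _ (by omega), ?_⟩
      have e : p + -1 + 1 = p := by ring
      rw [e, Function.update_self, Function.update_of_ne (by omega),
        Function.update_of_ne (by omega)]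
      rfl
    · intro i hi
      rw [Function.update_of_ne (by omega)]
      exact hl _ (by omega)
    · intro i hi
      rw [Function.update_of_ne (by omega)]
      rcases eq_or_ne i (p + 1) with rfl | hne
      · exact h2
      · exact hr _ (by omega)
  · rename_i w q' hP
    simp only [Option.elim_some, decide_eq_true_eq, List.cons_subset, List.nil_subset,
      and_true] at h
    obtain ⟨h1, h2⟩ := h
    have hMq := hM _ _ _ _ _ hP
    refine ⟨⟨q', ?_, ?_⟩, ?_, ?_⟩ <;> simp only [_root_.step, hMq, Dir.move]
    · apply h1
      rw [List.mem_map]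
      refine ⟨f (p + 1 + 1), hr _ (by omega), ?_⟩
      have e : p + 1 - 1 = p := by ring
      rw [e, Function.update_self, Function.update_of_ne (by omega),
        Function.update_of_ne (by omega)]
    · intro i hi
      rw [Function.update_of_ne (by omega)]
      rcases eq_or_ne i (p - 1) with rfl | hne
      · exact h2
      · exact hl _ (by omega)
    · intro i hi
      rw [Function.update_of_ne (by omega)]
      exact hr _ (by omega)

end Region

/-- A sufficient criterion for all machines that agree with `P` to run forever: extending the
region `A` at most `n` times yields a closed region that covers the initial configuration. -/
def Table.runsForever (P : Table) : ℕ → Region → Bool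
  | 0, _ => false
  | n + 1, A =>
    if A.closed P then decide ((0, 0, 0, 0) ∈ A.windows ∧ 0 ∈ A.left ∧ 0 ∈ A.right)
    else P.runsForever n (A.extend P)

lemma Table.state_ne_none_of_runsForever {P : Table} {M : Machine 2 2} (hM : P.Agrees M) {n : ℕ}
    {A : Region} (hP : P.runsForever n A = true) (t : ℕ) :
    ((step M)^[t] (init 2 2)).state ≠ none := by
  induction n generalizing A with
  | zero => simp [Table.runsForever] at hP
  | succ n ih =>
    unfold Table.runsForever at hP
    split at hP
    · rename_i hA
      obtain ⟨hw, hl, hr⟩ := of_decide_eq_true hP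
      have h : A.Covers ((step M)^[t] (init 2 2)) := by
        clear ih
        induction t with
        | zero => exact ⟨⟨0, rfl, hw⟩, fun _ _ => hl, fun _ _ => hr⟩
        | succ t iht =>
          rw [Function.iterate_succ_apply']
          exact iht.step hA hM
      obtain ⟨q, hq, -⟩ := h.window
      simp [hq]
    · exact ih hP

lemma Table.Agrees.state_ne_none {P : Table} {M : Machine 2 2} (hM : P.Agrees M)
    (hP : ∀ q a, (P q a).isSome = true) (t : ℕ) : ((step M)^[t] (init 2 2)).state ≠ none := by
  induction t with
  | zero => simp [init]
  | succ t ih =>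
    obtain ⟨q, hq⟩ := Option.ne_none_iff_exists'.mp ih
    rw [Function.iterate_succ_apply']
    generalize (step M)^[t] (init 2 2) = c at hq
    obtain ⟨⟨w, d, q'⟩, h⟩ := Option.isSome_iff_exists.mp (hP q (c.tape c.pos))
    simp [step, hq, hM _ _ _ _ _ h]

/-- The tape whose non-blank cells are those in `s`. -/
def tapeOf (s : Finset ℤ) : ℤ → Fin 2 := fun i => if i ∈ s then 1 else 0

/-- The non-blank cells after writing `w` at cell `i`. -/
def write (s : Finset ℤ) (i : ℤ) (w : Fin 2) : Finset ℤ :=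
  if w = 1 then insert i s else s.erase i

lemma update_tapeOf (s : Finset ℤ) (i : ℤ) (w : Fin 2) :
    Function.update (tapeOf s) i w = tapeOf (write s i w) := by
  funext j
  rcases eq_or_ne j i with rfl | h <;> fin_cases w <;> simp [tapeOf, write, *]

lemma sigmaCount_tapeOf (q : Option (Fin 2)) (p : ℤ) (s : Finset ℤ) :
    sigmaCount (⟨q, p, tapeOf s⟩ : Cfg 2 2) = s.card := by
  rw [← Set.ncard_coe_finset]
  simp [sigmaCount, tapeOf]

lemma step_tapeOf {M : Machine 2 2} {q w : Fin 2} {d : Dir} {q' : Option (Fin 2)} {p : ℤ}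
    {s : Finset ℤ} (h : M q (tapeOf s p) = (w, d, q')) :
    step M ⟨some q, p, tapeOf s⟩ = ⟨q', p + d.move, tapeOf (write s p w)⟩ := by
  simp [step, h, update_tapeOf]

/-- The eight non-halting transitions. -/
def rules : List Rule :=
  [(0, Dir.L, 0), (0, Dir.L, 1), (0, Dir.R, 0), (0, Dir.R, 1),
    (1, Dir.L, 0), (1, Dir.L, 1), (1, Dir.R, 0), (1, Dir.R, 1)]

lemma mem_rules (r : Rule) : r ∈ rules := by
  obtain ⟨w, d, q⟩ := r
  cases d <;> fin_cases w <;> fin_cases q <;> simp [rules]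

/-- Run the machine for at most `n` steps, branching over the possible transitions whenever an
unknown one is needed. Check that runs which halt leave at most 4 non-blank cells, and that the
others continue forever. -/
def search : ℕ → Table → Fin 2 → ℤ → Finset ℤ → Bool
  | 0, P, _, _, _ => decide (∀ q a, (P q a).isSome = true) || P.runsForever 12 Region.start
  | n + 1, P, q, p, s =>
    match P q (tapeOf s p) with
    | some (w, d, q') => search n P q' (p + d.move) (write s p w)
    | none => decide ((write s p 1).card ≤ 4) && rules.all fun r =>
        search n (P.define q (tapeOf s p) r) r.2.2 (p + r.2.1.move) (write s p r.1)

lemma HaltsIn.eq_succ {n k : ℕ} {M : Machine n k} {c : Cfg n k} {t m : ℕ} (h : HaltsIn M c t)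
    (hm : ((step M)^[m] c).state ≠ none) (hm' : ((step M)^[m + 1] c).state = none) :
    t = m + 1 := by
  have hle : t ≤ m + 1 := by
    by_contra! hlt
    exact h.2 _ hlt hm'
  refine hle.antisymm (Nat.succ_le_of_lt ?_)
  by_contra! hle'
  refine hm ?_
  have hfix : step M ((step M)^[t] c) = (step M)^[t] c := by simp [step, h.1]
  obtain ⟨j, rfl⟩ := Nat.exists_eq_add_of_le' hle'
  rw [Function.iterate_add_apply, Function.iterate_fixed hfix]
  exact h.1

lemma le_of_search {M : Machine 2 2} (hV : Valid M) {t : ℕ} (ht : HaltsIn M (init 2 2) t) :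
    ∀ (n m : ℕ) (P : Table) (q : Fin 2) (p : ℤ) (s : Finset ℤ), search n P q p s = true →
      P.Agrees M → (step M)^[m] (init 2 2) = ⟨some q, p, tapeOf s⟩ →
      t ≤ m + n ∧ sigmaCount ((step M)^[t] (init 2 2)) ≤ 4 := by
  intro n
  induction n with
  | zero =>
    intro m P q p s hs hP _
    rcases (Bool.or_eq_true _ _).mp hs with h | h
    · exact absurd ht.1 (hP.state_ne_none (of_decide_eq_true h) t)
    · exact absurd ht.1 (Table.state_ne_none_of_runsForever hP h t)
  | succ n ih =>
    intro m P q p s hs hP hm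
    have hstep : (step M)^[m + 1] (init 2 2) = step M ⟨some q, p, tapeOf s⟩ := by
      rw [Function.iterate_succ_apply', hm]
    rw [show m + (n + 1) = m + 1 + n by omega]
    unfold search at hs
    split at hs
    · rename_i w d q' hq
      rw [step_tapeOf (hP _ _ _ _ _ hq)] at hstep
      exact ih _ _ _ _ _ hs hP hstep
    · simp only [Bool.and_eq_true, decide_eq_true_eq, List.all_eq_true] at hs
      obtain ⟨hcard, hall⟩ := hs
      rcases hMq : M q (tapeOf s p) with ⟨w, d, _ | q'⟩
      · obtain ⟨hw, -⟩ := hV q (tapeOf s p) (by rw [hMq])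
        rw [hMq] at hw
        dsimp only at hw
        subst hw
        rw [step_tapeOf hMq] at hstep
        obtain rfl := ht.eq_succ (m := m) (by simp [hm]) (by simp [hstep])
        rw [hstep, sigmaCount_tapeOf]
        exact ⟨by omega, hcard⟩
      · rw [step_tapeOf hMq] at hstep
        exact ih _ _ _ _ _ (hall (w, d, q') (mem_rules _)) (hP.define hMq) hstep

lemma search_eq_true : search 6 (fun _ _ => none) 0 0 ∅ = true := by
  decide +kernel

lemma le_of_haltsIn {M : Machine 2 2} (hV : Valid M) {t : ℕ} (ht : HaltsIn M (init 2 2) t) :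
    t ≤ 6 ∧ sigmaCount ((step M)^[t] (init 2 2)) ≤ 4 := by
  simpa using le_of_search hV ht 6 0 _ 0 0 ∅ search_eq_true
    (fun _ _ _ _ _ h => by simp at h) rfl

/-- The 2-state 2-symbol busy beaver champion. -/
def champion : Machine 2 2 :=
  ![![(1, Dir.R, some 1), (1, Dir.L, some 1)], ![(1, Dir.L, some 0), (1, Dir.R, none)]]

lemma valid_champion : Valid champion := by
  intro q a h
  fin_cases q <;> fin_cases a <;> simp_all [champion]

lemma haltsIn_champion : HaltsIn champion (init 2 2) 6 := by
  unfold HaltsIn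
  decide

lemma sigmaCount_champion : sigmaCount ((step champion)^[6] (init 2 2)) = 4 := by
  have h : (step champion)^[6] (init 2 2) = ⟨none, 0, tapeOf {-2, -1, 0, 1}⟩ := by
    have h0 : init 2 2 = ⟨some 0, 0, tapeOf ∅⟩ := rfl
    simp only [Function.iterate_succ_apply, Function.iterate_zero_apply, h0]
    repeat rw [step_tapeOf (by rfl)]
    congr 2
    decide
  rw [h, sigmaCount_tapeOf]
  rfl

/-- Every 2-state 2-symbol machine that halts from the all-blank tape takes at most
6 steps and leaves at most 4 non-blank cells; both bounds are attained.
That is, `S(2,2) = 6` and `Σ(2,2) = 4`. -/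
theorem busy_beaver_values_2_2 :
    (∀ M : Machine 2 2, Valid M → ∀ t : ℕ, HaltsIn M (init 2 2) t →
        t ≤ 6 ∧ sigmaCount ((step M)^[t] (init 2 2)) ≤ 4) ∧
    (∃ M : Machine 2 2, Valid M ∧ HaltsIn M (init 2 2) 6) ∧
    (∃ M : Machine 2 2, Valid M ∧ ∃ t : ℕ, HaltsIn M (init 2 2) t ∧
        sigmaCount ((step M)^[t] (init 2 2)) = 4) ∧
    bbS 2 2 = 6 ∧ bbSigma 2 2 = 4 := by
  have hS : IsGreatest {t : ℕ | ∃ M : Machine 2 2, Valid M ∧ HaltsIn M (init 2 2) t} 6 :=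
    ⟨⟨champion, valid_champion, haltsIn_champion⟩,
      fun _ ⟨_, hV, ht⟩ => (le_of_haltsIn hV ht).1⟩
  have hσ : IsGreatest {m : ℕ | ∃ M : Machine 2 2, Valid M ∧
      ∃ t : ℕ, HaltsIn M (init 2 2) t ∧ sigmaCount ((step M)^[t] (init 2 2)) = m} 4 :=
    ⟨⟨champion, valid_champion, 6, haltsIn_champion, sigmaCount_champion⟩,
      fun _ ⟨_, hV, _, ht, hm⟩ => hm ▸ (le_of_haltsIn hV ht).2⟩
  exact ⟨fun _ hV _ ht => le_of_haltsIn hV ht, hS.1, hσ.1, hS.csSup_eq, hσ.csSup_eq⟩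
end

section
/- In Rado's busy beaver model, every Turing machine with 3 states and 2 symbols that halts when started in state A on the all-blank tape performs at most 21 steps and leaves at most 6 non-blank cells, and both bounds are attained by some such machine; that is, S(3,2) = 21 and Σ(3,2) = 6. -/
namespace BusyBeaver

/-! ### Halting and symmetries -/

theorem HaltsIn.succ {n k : ℕ} {M : Machine n k} {c : Cfg n k} {t : ℕ}
    (h : HaltsIn M c t) (hc : c.state ≠ none) : ∃ u, t = u + 1 ∧ HaltsIn M (step M c) u := by
  cases t with
  | zero => exact absurd h.1 hc
  | succ u =>
    refine ⟨u, rfl, ?_, fun i hi => ?_⟩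
    · simpa only [Function.iterate_succ_apply] using h.1
    · simpa only [Function.iterate_succ_apply] using h.2 (i + 1) (by omega)

theorem HaltsIn.eq_zero {n k : ℕ} {M : Machine n k} {c : Cfg n k} {t : ℕ}
    (h : HaltsIn M c t) (hc : c.state = none) : t = 0 := by
  by_contra ht
  exact h.2 0 (by omega) hc

theorem not_haltsIn_of_invariant {n k : ℕ} {M : Machine n k} (I : Cfg n k → Prop)
    (hstate : ∀ c, I c → c.state ≠ none) (hstep : ∀ c, I c → I (step M c))
    {c : Cfg n k} (hc : I c) (t : ℕ) : ¬ HaltsIn M c t := by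
  intro h
  induction t generalizing c with
  | zero => exact hstate c hc h.1
  | succ t ih =>
    obtain ⟨u, hu, hstep_halts⟩ := HaltsIn.succ h (hstate c hc)
    obtain rfl : t = u := by omega
    exact ih (hstep c hc) hstep_halts

/-- If the machine halts from the given configuration, then it performs at most `f` steps and
leaves at most `6` nonblank cells. -/
def Bounded (M : Machine 3 2) (f : ℕ) (c : Cfg 3 2) : Prop :=
  ∀ t, HaltsIn M c t → t ≤ f ∧ sigmaCount ((step M)^[t] c) ≤ 6

theorem Bounded.of_conj {M M' : Machine 3 2} {f : ℕ} {c : Cfg 3 2} (φ : Cfg 3 2 → Cfg 3 2)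
    (hφ : ∀ c, φ (step M c) = step M' (φ c))
    (hstate : ∀ c, (φ c).state = none ↔ c.state = none)
    (hsigma : ∀ c, sigmaCount (φ c) = sigmaCount c) (h : Bounded M' f (φ c)) :
    Bounded M f c := by
  have hiter (t : ℕ) : (step M')^[t] (φ c) = φ ((step M)^[t] c) :=
    ((Function.Semiconj.iterate_right (f := φ) hφ t) c).symm
  intro t ht
  have hhalt : HaltsIn M' (φ c) t := by
    refine ⟨?_, fun i hi => ?_⟩
    · rw [hiter, hstate]
      exact ht.1
    · rw [hiter, Ne, hstate]
      exact ht.2 i hi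
  simpa only [hiter, hsigma] using h t hhalt

/-- The opposite direction. -/
def flip : Dir → Dir
  | .L => .R
  | .R => .L

/-- The machine with left and right exchanged. -/
def mirror (M : Machine 3 2) : Machine 3 2 :=
  fun q a => ((M q a).1, flip (M q a).2.1, (M q a).2.2)

theorem Bounded.of_mirror {M : Machine 3 2} {f : ℕ} (h : Bounded (mirror M) f (init 3 2)) :
    Bounded M f (init 3 2) := by
  refine Bounded.of_conj (M' := mirror M) (fun c => ⟨c.state, -c.pos, fun i => c.tape (-i)⟩)
    ?_ (fun c => Iff.rfl) ?_ (by simpa [init] using h)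
  · intro c
    unfold step
    cases hc : c.state with
    | none => simp [hc]
    | some q =>
      simp only [mirror, neg_neg, Cfg.mk.injEq, true_and]
      refine ⟨?_, ?_⟩
      · cases (M q (c.tape c.pos)).2.1 <;> simp [flip, Dir.move] <;> ring
      · funext i
        by_cases hi : i = -c.pos
        · subst hi
          simp
        · rw [Function.update_of_ne hi, Function.update_of_ne (by omega)]
  · intro c
    unfold sigmaCount
    exact Set.ncard_preimage_of_injective_subset_range (s := {i : ℤ | c.tape i ≠ 0})
      neg_injective (by simp)

/-- The machine with its second and third state exchanged. -/
def swapStates (M : Machine 3 2) : Machine 3 2 :=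
  fun q a => ((M (Equiv.swap 1 2 q) a).1, (M (Equiv.swap 1 2 q) a).2.1,
    (M (Equiv.swap 1 2 q) a).2.2.map (Equiv.swap 1 2))

theorem Bounded.of_swapStates {M : Machine 3 2} {f : ℕ}
    (h : Bounded (swapStates M) f (init 3 2)) : Bounded M f (init 3 2) := by
  refine Bounded.of_conj (M' := swapStates M)
    (fun c => ⟨c.state.map (Equiv.swap 1 2), c.pos, c.tape⟩) ?_ ?_ (fun c => rfl) ?_
  · intro c
    unfold step
    cases hc : c.state <;> simp [hc, swapStates]
  · intro c
    simp
  · have : Equiv.swap (1 : Fin 3) 2 0 = 0 := by decide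
    simpa [init, this] using h

/-! ### Machines and configurations in explicit form -/

/-- The three working states. -/
inductive St : Type
  | A
  | B
  | C

/-- The index of a working state. -/
def St.fin : St → Fin 3
  | .A => 0
  | .B => 1
  | .C => 2

theorem St.exists_fin (q : Fin 3) : ∃ s : St, s.fin = q := by
  fin_cases q
  exacts [⟨.A, rfl⟩, ⟨.B, rfl⟩, ⟨.C, rfl⟩]

/-- The symbol for a bit. -/
def sym : Bool → Fin 2
  | false => 0
  | true => 1

theorem exists_sym (a : Fin 2) : ∃ b, sym b = a := by
  fin_cases a
  exacts [⟨false, rfl⟩, ⟨true, rfl⟩]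

/-- The direction for a bit. -/
def dir : Bool → Dir
  | false => .L
  | true => .R

/-- A transition into a working state: written bit, direction (`true` is right), next state. -/
structure Tr where
  write : Bool
  right : Bool
  next : St

/-- The value of the transition function described by a transition. -/
def Tr.value (t : Tr) : Fin 2 × Dir × Option (Fin 3) := (sym t.write, dir t.right, some t.next.fin)

/-- All transitions into working states. -/
def allTr : List Tr :=
  [⟨true, true, .A⟩, ⟨true, true, .B⟩, ⟨true, true, .C⟩,
   ⟨true, false, .A⟩, ⟨true, false, .B⟩, ⟨true, false, .C⟩,
   ⟨false, true, .A⟩, ⟨false, true, .B⟩, ⟨false, true, .C⟩,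
   ⟨false, false, .A⟩, ⟨false, false, .B⟩, ⟨false, false, .C⟩]

theorem mem_allTr (t : Tr) : t ∈ allTr := by
  obtain ⟨w, d, q⟩ := t
  cases w <;> cases d <;> cases q <;> simp [allTr]

theorem Tr.exists_value (v : Fin 2 × Dir × Option (Fin 3)) :
    v.2.2 = none ∨ ∃ t : Tr, v = t.value := by
  obtain ⟨a, d, _ | q⟩ := v
  · exact .inl rfl
  · obtain ⟨w, rfl⟩ := exists_sym a
    obtain ⟨s, rfl⟩ := St.exists_fin q
    cases d
    exacts [.inr ⟨⟨w, false, s⟩, rfl⟩, .inr ⟨⟨w, true, s⟩, rfl⟩]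

/-- A partially defined machine: `none` marks a transition that has not been chosen yet. -/
structure Partial where
  a0 : Option Tr
  a1 : Option Tr
  b0 : Option Tr
  b1 : Option Tr
  c0 : Option Tr
  c1 : Option Tr

/-- The transition of a partial machine in a given state reading a given bit. -/
def Partial.get (P : Partial) : St → Bool → Option Tr
  | .A, false => P.a0
  | .A, true => P.a1
  | .B, false => P.b0
  | .B, true => P.b1
  | .C, false => P.c0
  | .C, true => P.c1

/-- Define one transition of a partial machine. -/
def Partial.set (P : Partial) : St → Bool → Tr → Partial
  | .A, false, t => { P with a0 := some t }
  | .A, true, t => { P with a1 := some t }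
  | .B, false, t => { P with b0 := some t }
  | .B, true, t => { P with b1 := some t }
  | .C, false, t => { P with c0 := some t }
  | .C, true, t => { P with c1 := some t }

/-- Whether all transitions are defined. -/
def Partial.total (P : Partial) : Bool :=
  P.a0.isSome && P.a1.isSome && P.b0.isSome && P.b1.isSome && P.c0.isSome && P.c1.isSome

/-- The partial machine which only has a transition in state `A` reading a blank. -/
def Partial.single (t : Tr) : Partial := ⟨some t, none, none, none, none, none⟩

/-- The machine has all the transitions of the partial machine. -/
def Partial.Extends (P : Partial) (M : Machine 3 2) : Prop :=
  ∀ q s t, P.get q s = some t → M q.fin (sym s) = t.value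

theorem Partial.Extends.set {P : Partial} {M : Machine 3 2} (h : P.Extends M) {q : St} {s : Bool}
    {t : Tr} (ht : M q.fin (sym s) = t.value) : (P.set q s t).Extends M := by
  intro q' s' t' h'
  cases q <;> cases s <;> cases q' <;> cases s' <;>
    first
    | exact h _ _ _ h'
    | (obtain rfl : t = t' := Option.some.inj h'
       exact ht)

theorem Partial.total_set_iff (P : Partial) (q : St) (s : Bool) (t t' : Tr) :
    (P.set q s t).total = (P.set q s t').total := by
  cases q <;> cases s <;> rfl

theorem Partial.exists_get_of_total {P : Partial} (h : P.total = true) (q : St) (s : Bool) :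
    ∃ t, P.get q s = some t := by
  simp only [Partial.total, Bool.and_eq_true, Option.isSome_iff_exists] at h
  cases q <;> cases s <;> simp only [Partial.get] <;> tauto

theorem Partial.Extends.single {M : Machine 3 2} {t : Tr} (h : M 0 0 = t.value) :
    (Partial.single t).Extends M := by
  intro q s t' h'
  cases q <;> cases s <;> simp only [Partial.single, Partial.get, reduceCtorEq] at h'
  obtain rfl : t = t' := Option.some.inj h'
  exact h

theorem Partial.Extends.not_haltsIn {P : Partial} {M : Machine 3 2} (h : P.Extends M)
    (htotal : P.total = true) {c : Cfg 3 2} (hc : c.state ≠ none) (t : ℕ) : ¬ HaltsIn M c t := by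
  refine not_haltsIn_of_invariant (fun c => c.state ≠ none) (fun _ => id) (fun c hc => ?_) hc t
  obtain ⟨i, hi⟩ := Option.ne_none_iff_exists'.1 hc
  obtain ⟨q, rfl⟩ := St.exists_fin i
  obtain ⟨s, hs⟩ := exists_sym (c.tape c.pos)
  obtain ⟨t, ht⟩ := P.exists_get_of_total htotal q s
  simp [step, hi, ← hs, h q s t ht, Tr.value]

/-- The configuration is in state `q` reading the bit `s`, with `l` and `r` to the left and right
of the head, listed from the head outwards and followed by blanks. -/
structure Rep (c : Cfg 3 2) (l : List Bool) (q : St) (s : Bool) (r : List Bool) : Prop where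
  state : c.state = some q.fin
  head : c.tape c.pos = sym s
  left : ∀ i : ℕ, c.tape (c.pos - 1 - i) = sym (l.getD i false)
  right : ∀ i : ℕ, c.tape (c.pos + 1 + i) = sym (r.getD i false)

theorem rep_init : Rep (init 3 2) [] .A false [] where
  state := rfl
  head := rfl
  left _ := rfl
  right _ := rfl

theorem Rep.state_ne_none {c : Cfg 3 2} {l r : List Bool} {q : St} {s : Bool}
    (h : Rep c l q s r) : c.state ≠ none := by
  simp [h.state]

theorem Rep.step_eq {c : Cfg 3 2} {l r : List Bool} {q : St} {s : Bool} (h : Rep c l q s r)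
    (M : Machine 3 2) : step M c =
      ⟨(M q.fin (sym s)).2.2, c.pos + (M q.fin (sym s)).2.1.move,
        Function.update c.tape c.pos (M q.fin (sym s)).1⟩ := by
  simp [step, h.state, h.head]

theorem getD_zero_eq_headD (l : List Bool) : l.getD 0 false = l.headD false := by
  cases l <;> rfl

theorem getD_succ_eq_tail (l : List Bool) (i : ℕ) : l.getD (i + 1) false = l.tail.getD i false := by
  cases l <;> rfl

theorem Rep.step_right {M : Machine 3 2} {c : Cfg 3 2} {l r : List Bool} {q q' : St} {s w : Bool}
    (h : Rep c l q s r) (hM : M q.fin (sym s) = (⟨w, true, q'⟩ : Tr).value) :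
    Rep (step M c) (w :: l) q' (r.headD false) r.tail := by
  rw [h.step_eq, hM]
  refine ⟨rfl, ?_, fun i => ?_, fun i => ?_⟩ <;> simp only [Tr.value, dir, Dir.move]
  · rw [Function.update_of_ne (by omega), ← getD_zero_eq_headD, ← h.right 0]
    simp
  · cases i with
    | zero => simp
    | succ i =>
      rw [Function.update_of_ne (by omega), List.getD_cons_succ, ← h.left i]
      congr 1
      push_cast
      ring
  · rw [Function.update_of_ne (by omega), ← getD_succ_eq_tail, ← h.right (i + 1)]
    congr 1
    push_cast
    ring

theorem Rep.step_left {M : Machine 3 2} {c : Cfg 3 2} {l r : List Bool} {q q' : St} {s w : Bool}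
    (h : Rep c l q s r) (hM : M q.fin (sym s) = (⟨w, false, q'⟩ : Tr).value) :
    Rep (step M c) l.tail q' (l.headD false) (w :: r) := by
  rw [h.step_eq, hM]
  refine ⟨rfl, ?_, fun i => ?_, fun i => ?_⟩ <;> simp only [Tr.value, dir, Dir.move]
  · rw [Function.update_of_ne (by omega), ← getD_zero_eq_headD, ← h.left 0]
    congr 1
    push_cast
    ring
  · rw [Function.update_of_ne (by omega), ← getD_succ_eq_tail, ← h.left (i + 1)]
    congr 1
    push_cast
    ring
  · cases i with
    | zero => simp
    | succ i =>
      rw [Function.update_of_ne (by omega), List.getD_cons_succ, ← h.right i]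
      congr 1
      push_cast
      ring

theorem encard_getD_le (l : List Bool) : {i : ℕ | l.getD i false = true}.encard ≤ l.count true := by
  induction l with
  | nil => simp
  | cons b l ih =>
    have hsub : {i : ℕ | (b :: l).getD i false = true} ⊆
        {i : ℕ | i = 0 ∧ b = true} ∪ Nat.succ '' {i : ℕ | l.getD i false = true} := by
      rintro (_ | i) hi
      · exact .inl ⟨rfl, hi⟩
      · exact .inr ⟨i, hi, rfl⟩
    refine (Set.encard_le_encard hsub).trans ((Set.encard_union_le _ _).trans ?_)
    rw [List.count_cons, Nat.cast_add, add_comm]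
    refine add_le_add ((Set.encard_image_le _ _).trans ih) ?_
    cases b <;> simp

theorem Rep.sigmaCount_step_le {M : Machine 3 2} {c : Cfg 3 2} {l r : List Bool} {q : St} {s : Bool}
    (h : Rep c l q s r) : sigmaCount (step M c) ≤ l.count true + r.count true + 1 := by
  have hsub : {i : ℤ | (step M c).tape i ≠ 0} ⊆
      ((fun i : ℕ => c.pos - 1 - (i : ℤ)) '' {i : ℕ | l.getD i false = true} ∪
        (fun i : ℕ => c.pos + 1 + (i : ℤ)) '' {i : ℕ | r.getD i false = true}) ∪ {c.pos} := by
    have hsym (b : Bool) (hb : sym b ≠ 0) : b = true := by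
      cases b
      · exact absurd rfl hb
      · rfl
    intro i hi
    simp only [h.step_eq, Set.mem_ofPred_eq] at hi
    rcases lt_trichotomy i c.pos with hlt | rfl | hgt
    · obtain ⟨j, rfl⟩ : ∃ j : ℕ, i = c.pos - 1 - j := ⟨(c.pos - 1 - i).toNat, by omega⟩
      rw [Function.update_of_ne hlt.ne, h.left] at hi
      exact .inl (.inl ⟨j, hsym _ hi, rfl⟩)
    · exact .inr rfl
    · obtain ⟨j, rfl⟩ : ∃ j : ℕ, i = c.pos + 1 + j := ⟨(i - c.pos - 1).toNat, by omega⟩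
      rw [Function.update_of_ne hgt.ne', h.right] at hi
      exact .inl (.inr ⟨j, hsym _ hi, rfl⟩)
  have hle : {i : ℤ | (step M c).tape i ≠ 0}.encard ≤ (l.count true + r.count true + 1 : ℕ) := by
    refine (Set.encard_le_encard hsub).trans ((Set.encard_union_le _ _).trans ?_)
    push_cast
    refine add_le_add ((Set.encard_union_le _ _).trans (add_le_add ?_ ?_)) (by simp)
    · exact (Set.encard_image_le _ _).trans (encard_getD_le l)
    · exact (Set.encard_image_le _ _).trans (encard_getD_le r)
  exact (Set.encard_le_coe_iff_finite_ncard_le.1 hle).2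

/-! ### Nontermination by closed tape languages -/

/-- A deterministic automaton with states `0, …, size - 1` that reads one half of the tape from
the far blank end towards the head, and rests in state `0` on blanks. -/
structure Auto where
  size : ℕ
  next : ℕ → Bool → ℕ
  size_le : size ≤ 16
  next_lt : ∀ x < size, ∀ b, next x b < size
  size_pos : 0 < size
  next_zero : next 0 false = 0

/-- The state reached after reading a half tape, given from the head outwards. -/
def Auto.eval (D : Auto) : List Bool → ℕ
  | [] => 0
  | b :: l => D.next (D.eval l) b

theorem Auto.eval_lt (D : Auto) (l : List Bool) : D.eval l < D.size := by
  induction l with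
  | nil => exact D.size_pos
  | cons b l ih => exact D.next_lt _ ih b

theorem Auto.eval_eq (D : Auto) (l : List Bool) :
    D.eval l = D.next (D.eval l.tail) (l.headD false) := by
  cases l
  · exact D.next_zero.symm
  · rfl

/-- The possible last steps of a run of the automaton ending in a given state. -/
def Auto.prev (D : Auto) (y : ℕ) : List (ℕ × Bool) :=
  ((List.range D.size).flatMap fun x => [(x, false), (x, true)]).filter
    fun p => Nat.beq (D.next p.1 p.2) y

theorem Auto.mem_prev {D : Auto} {x y : ℕ} {b : Bool} :
    (x, b) ∈ D.prev y ↔ x < D.size ∧ D.next x b = y := by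
  cases b <;> simp [Auto.prev]

theorem Auto.tail_mem_prev (D : Auto) (l : List Bool) :
    (D.eval l.tail, l.headD false) ∈ D.prev (D.eval l) :=
  Auto.mem_prev.2 ⟨D.eval_lt _, (D.eval_eq l).symm⟩

/-- A configuration abstracted by automata states for the left and right half tapes. -/
structure Item where
  left : ℕ
  state : St
  head : Bool
  right : ℕ

/-- The number of a pair of a state and a bit. -/
def ctl : St → Bool → ℕ
  | .A, false => 0
  | .A, true => 1
  | .B, false => 2
  | .B, true => 3
  | .C, false => 4
  | .C, true => 5

/-- A numbering of the items, injective on those whose automata states are below `16`. -/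
def Item.code (i : Item) : ℕ :=
  Nat.add (Nat.mul 8 (Nat.add (Nat.mul 16 i.left) i.right)) (ctl i.state i.head)

/-- The automata states of an item are in range. -/
def Item.InRange (D E : Auto) (i : Item) : Prop := i.left < D.size ∧ i.right < E.size

theorem ctl_lt (q : St) (s : Bool) : ctl q s < 8 := by
  cases q <;> cases s <;> simp [ctl]

theorem ctl_inj {q q' : St} {s s' : Bool} (h : ctl q s = ctl q' s') : q = q' ∧ s = s' := by
  cases q <;> cases s <;> cases q' <;> cases s' <;> simp_all [ctl]

theorem Item.code_inj {D E : Auto} {i j : Item} (hi : i.InRange D E) (hj : j.InRange D E)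
    (h : i.code = j.code) : i = j := by
  obtain ⟨x, q, s, y⟩ := i
  obtain ⟨x', q', s', y'⟩ := j
  have h₁ := ctl_lt q s
  have h₂ := ctl_lt q' s'
  have h₃ := E.size_le
  simp only [Item.code, Item.InRange, Nat.add_eq, Nat.mul_eq] at h hi hj
  obtain ⟨rfl, rfl⟩ := ctl_inj (show ctl q s = ctl q' s' by omega)
  obtain rfl : x = x' := by omega
  obtain rfl : y = y' := by omega
  rfl

/-- `j` is an abstract successor of `i` under the transition `t`. -/
def Item.Succ (D E : Auto) (i : Item) (t : Tr) (j : Item) : Prop :=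
  match t.right with
  | true => j.state = t.next ∧ j.left = D.next i.left t.write ∧ (j.right, j.head) ∈ E.prev i.right
  | false => j.state = t.next ∧ j.right = E.next i.right t.write ∧ (j.left, j.head) ∈ D.prev i.left

theorem Item.Succ.inRange {D E : Auto} {i j : Item} {t : Tr} (h : i.Succ D E t j)
    (hi : i.InRange D E) : j.InRange D E := by
  obtain ⟨w, d, q⟩ := t
  cases d
  · obtain ⟨-, hr, hl⟩ := h
    exact ⟨(Auto.mem_prev.1 hl).1, hr ▸ E.next_lt _ hi.2 _⟩
  · obtain ⟨-, hl, hr⟩ := h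
    exact ⟨hl ▸ D.next_lt _ hi.1 _, (Auto.mem_prev.1 hr).1⟩

/-- Every item in the set has a defined transition whose abstract successors satisfy `R`. -/
def StepsInto (P : Partial) (D E : Auto) (S R : Item → Prop) : Prop :=
  ∀ i, i.InRange D E → S i → ∃ t, P.get i.state i.head = some t ∧ ∀ j, i.Succ D E t j → R j

theorem StepsInto.not_haltsIn {P : Partial} {D E : Auto} {S : Item → Prop}
    (hS : StepsInto P D E S S) {M : Machine 3 2} (hM : P.Extends M) {c : Cfg 3 2}
    {l r : List Bool} {q : St} {s : Bool} (hc : Rep c l q s r)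
    (hi : S ⟨D.eval l, q, s, E.eval r⟩) (t : ℕ) : ¬ HaltsIn M c t := by
  refine not_haltsIn_of_invariant
    (fun c => ∃ l q s r, Rep c l q s r ∧ S ⟨D.eval l, q, s, E.eval r⟩) ?_ ?_ ⟨l, q, s, r, hc, hi⟩ t
  · rintro c ⟨l, q, s, r, hc, -⟩
    exact hc.state_ne_none
  · rintro c ⟨l, q, s, r, hc, hi⟩
    obtain ⟨⟨w, d, q'⟩, ht, hsucc⟩ := hS _ ⟨D.eval_lt l, E.eval_lt r⟩ hi
    have hMt := hM _ _ _ ht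
    cases d
    · exact ⟨_, _, _, _, hc.step_left hMt, hsucc _ ⟨rfl, rfl, D.tail_mem_prev l⟩⟩
    · exact ⟨_, _, _, _, hc.step_right hMt, hsucc _ ⟨rfl, rfl, E.tail_mem_prev r⟩⟩

/-- Apply a function to a natural number, reducing the number to a numeral first. -/
def force (n : ℕ) (k : ℕ → Bool) : Bool :=
  match n with
  | 0 => k 0
  | m + 1 => k (Nat.succ m)

theorem force_eq (n : ℕ) (k : ℕ → Bool) : force n k = k n := by
  cases n <;> rfl

/-- Push the items with given left part on a worklist. -/
def pushRight (q : St) (x : ℕ) (w : List Item) : List (ℕ × Bool) → List Item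
  | [] => w
  | (y, b) :: l => ⟨x, q, b, y⟩ :: pushRight q x w l

/-- Push the items with given right part on a worklist. -/
def pushLeft (q : St) (y : ℕ) (w : List Item) : List (ℕ × Bool) → List Item
  | [] => w
  | (x, b) :: l => ⟨x, q, b, y⟩ :: pushLeft q y w l

theorem mem_pushRight {q : St} {x : ℕ} {w : List Item} {l : List (ℕ × Bool)} {i : Item} :
    i ∈ pushRight q x w l ↔ (i.state = q ∧ i.left = x ∧ (i.right, i.head) ∈ l) ∨ i ∈ w := by
  obtain ⟨x', q', s', y'⟩ := i
  induction l with
  | nil => simp [pushRight]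
  | cons p l ih =>
    simp only [pushRight, List.mem_cons, ih, Item.mk.injEq, Prod.ext_iff]
    tauto

theorem mem_pushLeft {q : St} {y : ℕ} {w : List Item} {l : List (ℕ × Bool)} {i : Item} :
    i ∈ pushLeft q y w l ↔ (i.state = q ∧ i.right = y ∧ (i.left, i.head) ∈ l) ∨ i ∈ w := by
  obtain ⟨x', q', s', y'⟩ := i
  induction l with
  | nil => simp [pushLeft]
  | cons p l ih =>
    simp only [pushLeft, List.mem_cons, ih, Item.mk.injEq, Prod.ext_iff]
    tauto

/-- Depth-first search through the abstract configurations reachable from a worklist, where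
`seen` is the bit mask of the visited items; the search fails at undefined transitions. -/
def explore (P : Partial) (D E : Auto) : ℕ → ℕ → List Item → Bool
  | _, _, [] => true
  | 0, _, _ => false
  | f + 1, seen, ⟨x, q, s, y⟩ :: w =>
    force (Nat.lor seen (Nat.shiftLeft 1 (Item.code ⟨x, q, s, y⟩))) fun seen' =>
      match Nat.beq seen seen' with
      | true => explore P D E f seen w
      | false =>
        match P.get q s with
        | none => false
        | some ⟨t, d, q⟩ =>
          match d with
          | true => force (D.next x t) fun x =>
              explore P D E f seen' (pushRight q x w (E.prev y))
          | false => force (E.next y t) fun y =>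
              explore P D E f seen' (pushLeft q y w (D.prev x))

theorem testBit_lor_shiftLeft_one (m n k : ℕ) :
    (Nat.lor m (Nat.shiftLeft 1 n)).testBit k = true ↔ m.testBit k = true ∨ k = n := by
  change (m ||| 1 <<< n).testBit k = true ↔ _
  rw [Nat.testBit_or, Nat.shiftLeft_eq, one_mul, Nat.testBit_two_pow, Bool.or_eq_true,
    decide_eq_true_iff, eq_comm (a := n)]

theorem exists_stepsInto_of_explore {P : Partial} {D E : Auto} {f seen : ℕ} {w : List Item}
    (h : explore P D E f seen w = true) (hw : ∀ i ∈ w, i.InRange D E)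
    (hseen : StepsInto P D E (fun i => seen.testBit i.code = true)
      (fun j => seen.testBit j.code = true ∨ j ∈ w)) :
    ∃ S : Item → Prop, StepsInto P D E S S ∧ (∀ i, seen.testBit i.code = true → S i) ∧
      ∀ i ∈ w, S i := by
  induction f generalizing seen w with
  | zero =>
    cases w with
    | nil => exact ⟨_, by simpa using hseen, fun _ => id, by simp⟩
    | cons i w => simp [explore] at h
  | succ f ih =>
    cases w with
    | nil => exact ⟨_, by simpa using hseen, fun _ => id, by simp⟩
    | cons i w =>
      obtain ⟨x, q, s, y⟩ := i
      simp only [explore, force_eq] at h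
      split at h
      · next heq =>
        have hi : seen.testBit (Item.code ⟨x, q, s, y⟩) = true := by
          rw [Nat.eq_of_beq_eq_true heq, testBit_lor_shiftLeft_one]
          exact .inr rfl
        obtain ⟨S, hS, hsub, hmem⟩ := ih h (fun i hi => hw i (List.mem_cons_of_mem _ hi)) (by
          intro j hj hbit
          obtain ⟨t, ht, hsucc⟩ := hseen j hj hbit
          refine ⟨t, ht, fun k hk => ?_⟩
          rcases hsucc k hk with h₁ | h₁
          · exact .inl h₁
          · rcases List.mem_cons.1 h₁ with rfl | h₁
            exacts [.inl hi, .inr h₁])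
        refine ⟨S, hS, hsub, fun j hj => ?_⟩
        rcases List.mem_cons.1 hj with rfl | hj
        exacts [hsub _ hi, hmem j hj]
      · have hrange : Item.InRange D E ⟨x, q, s, y⟩ := hw _ List.mem_cons_self
        obtain ⟨⟨t, d, q'⟩, hget⟩ | hget : (∃ t, P.get q s = some t) ∨ P.get q s = none := by
          cases P.get q s <;> simp
        swap
        · simp [hget] at h
        obtain ⟨w', hw', hex⟩ : ∃ w' : List Item,
            (∀ j, j ∈ w' ↔ Item.Succ D E ⟨x, q, s, y⟩ ⟨t, d, q'⟩ j ∨ j ∈ w) ∧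
            explore P D E f (Nat.lor seen (Nat.shiftLeft 1 (Item.code ⟨x, q, s, y⟩))) w' = true := by
          rw [hget] at h
          cases d
          · exact ⟨_, fun j => mem_pushLeft, h⟩
          · exact ⟨_, fun j => mem_pushRight, h⟩
        obtain ⟨S, hS, hsub, hmem⟩ := ih hex (by
            intro j hj
            rcases (hw' j).1 hj with h₁ | h₁
            exacts [h₁.inRange hrange, hw j (List.mem_cons_of_mem _ h₁)]) (by
          intro j hj hbit
          rw [testBit_lor_shiftLeft_one] at hbit
          by_cases hij : j = ⟨x, q, s, y⟩
          · subst hij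
            exact ⟨_, hget, fun k hk => .inr ((hw' k).2 (.inl hk))⟩
          · obtain ⟨t, ht, hsucc⟩ := hseen j hj
              (hbit.resolve_right fun he => hij (Item.code_inj hj hrange he))
            refine ⟨t, ht, fun k hk => ?_⟩
            simp only [testBit_lor_shiftLeft_one, hw']
            rcases hsucc k hk with h₁ | h₁
            · exact .inl (.inl h₁)
            · rcases List.mem_cons.1 h₁ with rfl | h₁
              exacts [.inl (.inr rfl), .inr (.inr h₁)])
        refine ⟨S, hS, fun j hj => hsub j ((testBit_lor_shiftLeft_one _ _ _).2 (.inl hj)), ?_⟩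
        intro j hj
        rcases List.mem_cons.1 hj with rfl | hj
        · exact hsub _ ((testBit_lor_shiftLeft_one _ _ _).2 (.inr rfl))
        · exact hmem j ((hw' j).2 (.inr hj))

/-- The automaton remembering the last `n` cells. -/
def Auto.window (n : ℕ) (hn : n ≤ 4) : Auto where
  size := 2 ^ n
  next x b := Nat.mod (Nat.add (Nat.mul 2 x) b.toNat) (2 ^ n)
  size_le := Nat.pow_le_pow_right (n := 2) (by omega) hn
  next_lt _ _ _ := Nat.mod_lt _ (by positivity)
  size_pos := by positivity
  next_zero := Nat.zero_mod _

/-- The automaton remembering the content of the half tape up to its farthest nonblank cell, as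
long as this content has a value below `2 ^ n - 1` as a binary number. -/
def Auto.content (n : ℕ) (hn : n ≤ 4) : Auto where
  size := 2 ^ n
  next x b := Nat.min (Nat.add (Nat.mul 2 x) b.toNat) (2 ^ n - 1)
  size_le := Nat.pow_le_pow_right (n := 2) (by omega) hn
  next_lt _ _ _ := (Nat.min_le_right _ _).trans_lt (Nat.sub_lt (by positivity) one_pos)
  size_pos := by positivity
  next_zero := Nat.zero_min _

/-- Look up a decimal digit in a transition table. -/
def lookup (digits x : ℕ) (b : Bool) : ℕ :=
  match b with
  | false => Nat.mod (Nat.div digits (Nat.pow 100 x)) 10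
  | true => Nat.mod (Nat.div digits (Nat.mul 10 (Nat.pow 100 x))) 10

/-- The automaton given by a table whose decimal digits, starting from the least significant
one, are the successors of `(0, false)`, `(0, true)`, `(1, false)`, …. -/
def Auto.table (size digits : ℕ)
    (h : size ≤ 16 ∧ (∀ x < size, ∀ b, lookup digits x b < size) ∧ 0 < size ∧
      lookup digits 0 false = 0) : Auto where
  size := size
  next := lookup digits
  size_le := h.1
  next_lt := h.2.1
  size_pos := h.2.2.1
  next_zero := h.2.2.2

/-- Pairs of automata that prove the nontermination of all nonhalting machines with three states
and two symbols, up to symmetry. -/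
def autoPairs : List (Auto × Auto) :=
  [(.table 3 222210 (by decide), .table 3 222210 (by decide)),
   (.window 2 (by decide), .content 3 (by decide)),
   (.table 4 22223210 (by decide), .window 2 (by decide)),
   (.content 3 (by decide), .window 4 (by decide)),
   (.table 3 221210 (by decide), .table 4 33331210 (by decide)),
   (.table 4 33133210 (by decide), .table 4 33133210 (by decide)),
   (.window 4 (by decide), .content 4 (by decide)),
   (.table 3 222110 (by decide), .table 3 221210 (by decide)),
   (.table 3 220210 (by decide), .table 3 220210 (by decide)),
   (.table 2 1010 (by decide), .table 2 1010 (by decide)),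
   (.content 4 (by decide), .window 4 (by decide)),
   (.table 2 10 (by decide), .table 4 33113210 (by decide)),
   (.table 4 33113210 (by decide), .table 2 10 (by decide)),
   (.table 3 220210 (by decide), .table 4 33332010 (by decide))]

/-- Whether one of the automata pairs shows that no undefined transition is ever reached. -/
def loops (P : Partial) (l : List Bool) (q : St) (s : Bool) (r : List Bool) : Bool :=
  autoPairs.any fun p => explore P p.1 p.2 600 0 [⟨p.1.eval l, q, s, p.2.eval r⟩]

theorem not_haltsIn_of_loops {P : Partial} {M : Machine 3 2} (hM : P.Extends M) {c : Cfg 3 2}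
    {l r : List Bool} {q : St} {s : Bool} (hc : Rep c l q s r) (h : loops P l q s r = true)
    (t : ℕ) : ¬ HaltsIn M c t := by
  obtain ⟨⟨D, E⟩, -, h⟩ := List.any_eq_true.1 h
  obtain ⟨S, hS, -, hmem⟩ := exists_stepsInto_of_explore h
    (by simpa using ⟨D.eval_lt l, E.eval_lt r⟩) (by intro i _ hi; simp at hi)
  exact hS.not_haltsIn hM hc (hmem _ List.mem_cons_self) t

/-! ### The search -/

/-- Define one transition of a partial machine and pass the result on in explicit form. -/
def Partial.setThen (P : Partial) (q : St) (s : Bool) (t : Tr) (k : Partial → Bool) : Bool :=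
  match P, q, s with
  | ⟨_, a1, b0, b1, c0, c1⟩, .A, false => k ⟨some t, a1, b0, b1, c0, c1⟩
  | ⟨a0, _, b0, b1, c0, c1⟩, .A, true => k ⟨a0, some t, b0, b1, c0, c1⟩
  | ⟨a0, a1, _, b1, c0, c1⟩, .B, false => k ⟨a0, a1, some t, b1, c0, c1⟩
  | ⟨a0, a1, b0, _, c0, c1⟩, .B, true => k ⟨a0, a1, b0, some t, c0, c1⟩
  | ⟨a0, a1, b0, b1, _, c1⟩, .C, false => k ⟨a0, a1, b0, b1, some t, c1⟩
  | ⟨a0, a1, b0, b1, c0, _⟩, .C, true => k ⟨a0, a1, b0, b1, c0, some t⟩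

theorem Partial.setThen_eq (P : Partial) (q : St) (s : Bool) (t : Tr) (k : Partial → Bool) :
    P.setThen q s t k = k (P.set q s t) := by
  cases q <;> cases s <;> rfl

/-- Write a bit, move, and pass the resulting tape on in explicit form. -/
def moveThen (l r : List Bool) (w d : Bool) (k : List Bool → Bool → List Bool → Bool) : Bool :=
  match d, l, r with
  | true, l, [] => k (w :: l) false []
  | true, l, b :: r => k (w :: l) b r
  | false, [], r => k [] false (w :: r)
  | false, b :: l, r => k l b (w :: r)

theorem Rep.exists_of_moveThen {M : Machine 3 2} {c : Cfg 3 2} {l r : List Bool} {q q' : St}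
    {s w d : Bool} (h : Rep c l q s r) (hM : M q.fin (sym s) = (⟨w, d, q'⟩ : Tr).value)
    {k : List Bool → Bool → List Bool → Bool} (hk : moveThen l r w d k = true) :
    ∃ l' s' r', Rep (step M c) l' q' s' r' ∧ k l' s' r' = true := by
  cases d
  · refine ⟨_, _, _, h.step_left hM, ?_⟩
    cases l <;> exact hk
  · refine ⟨_, _, _, h.step_right hM, ?_⟩
    cases r <;> exact hk

/-- Search through all completions of a partial machine, starting from a configuration with half
tapes `l` and `r`, for at most the given number of steps, checking that the machines that halt
leave at most `6` nonblank cells and that the others never halt. -/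
def search : ℕ → Partial → List Bool → St → Bool → List Bool → Bool
  | 0, P, l, q, s, r => loops P l q s r
  | f + 1, P, l, q, s, r =>
    match P.get q s with
    | some ⟨w, d, q'⟩ => moveThen l r w d fun l s r => search f P l q' s r
    | none =>
      Nat.ble (l.count true + r.count true + 1) 6 &&
        ((P.set q s ⟨true, true, .A⟩).total ||
          allTr.all fun
            | ⟨w, d, q'⟩ =>
              P.setThen q s ⟨w, d, q'⟩ fun P => moveThen l r w d fun l s r => search f P l q' s r)

theorem Rep.bounded_of_halt {M : Machine 3 2} {f : ℕ} {c : Cfg 3 2} {l r : List Bool} {q : St}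
    {s : Bool} (hc : Rep c l q s r) (hM : (M q.fin (sym s)).2.2 = none)
    (hcount : l.count true + r.count true + 1 ≤ 6) : Bounded M (f + 1) c := by
  intro t ht
  obtain ⟨u, rfl, hu⟩ := HaltsIn.succ ht hc.state_ne_none
  obtain rfl := HaltsIn.eq_zero hu (by simp [hc.step_eq, hM])
  exact ⟨by omega, hc.sigmaCount_step_le.trans hcount⟩

theorem Rep.bounded_of_step {M : Machine 3 2} {f : ℕ} {c : Cfg 3 2} {l r : List Bool} {q : St}
    {s : Bool} (hc : Rep c l q s r) (h : Bounded M f (step M c)) : Bounded M (f + 1) c := by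
  intro t ht
  obtain ⟨u, rfl, hu⟩ := HaltsIn.succ ht hc.state_ne_none
  obtain ⟨h₁, h₂⟩ := h u hu
  exact ⟨by omega, by simpa only [Function.iterate_succ_apply] using h₂⟩

theorem bounded_of_search {M : Machine 3 2} {f : ℕ} {P : Partial} {c : Cfg 3 2}
    {l r : List Bool} {q : St} {s : Bool} (h : search f P l q s r = true) (hM : P.Extends M)
    (hc : Rep c l q s r) : Bounded M f c := by
  induction f generalizing P c l q s r with
  | zero => exact fun t ht => absurd ht (not_haltsIn_of_loops hM hc h t)
  | succ f ih =>
    rw [search] at h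
    split at h
    · next w d q' hget =>
      obtain ⟨l', s', r', hc', h'⟩ := hc.exists_of_moveThen (hM _ _ _ hget) h
      exact hc.bounded_of_step (ih h' hM hc')
    · rw [Bool.and_eq_true, Bool.or_eq_true] at h
      obtain ⟨hcount, h⟩ := h
      rcases Tr.exists_value (M q.fin (sym s)) with hnone | ⟨⟨w, d, q'⟩, htr⟩
      · exact hc.bounded_of_halt hnone (Nat.le_of_ble_eq_true hcount)
      · have hM' := hM.set htr
        rcases h with htotal | hall
        · rw [P.total_set_iff q s _ ⟨w, d, q'⟩] at htotal
          exact fun t ht => absurd ht (hM'.not_haltsIn htotal hc.state_ne_none t)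
        · have h := List.all_eq_true.1 hall _ (mem_allTr ⟨w, d, q'⟩)
          simp only [Partial.setThen_eq] at h
          obtain ⟨l', s', r', hc', h'⟩ := hc.exists_of_moveThen htr h
          exact hc.bounded_of_step (ih h' hM' hc')

theorem search_right (w : Bool) (t : Tr) :
    ((Partial.single ⟨w, true, .B⟩).setThen .B false t fun P =>
      moveThen [w] [] t.write t.right fun l s r => search 19 P l t.next s r) = true := by
  obtain ⟨w', d, q⟩ := t
  cases w <;> cases w' <;> cases d <;> cases q <;> decide +kernel

theorem search_stay (w d : Bool) :
    search 21 (.single ⟨w, d, .A⟩) [] .A false [] = true := by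
  cases w <;> cases d <;> decide +kernel

theorem bounded_of_right {M : Machine 3 2} {w : Bool} (hM : M 0 0 = (⟨w, true, .B⟩ : Tr).value) :
    Bounded M 21 (init 3 2) := by
  have hstep : Rep (step M (init 3 2)) [w] .B false [] := rep_init.step_right hM
  refine rep_init.bounded_of_step ?_
  rcases Tr.exists_value (M 1 0) with hnone | ⟨t, ht⟩
  · exact hstep.bounded_of_halt hnone (by cases w <;> decide)
  · have h := search_right w t
    rw [Partial.setThen_eq] at h
    obtain ⟨l, s, r, hc, hsearch⟩ := hstep.exists_of_moveThen ht h
    exact hstep.bounded_of_step (bounded_of_search hsearch ((Partial.Extends.single hM).set ht) hc)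

theorem bounded_of_toB {M : Machine 3 2} {w d : Bool} (hM : M 0 0 = (⟨w, d, .B⟩ : Tr).value) :
    Bounded M 21 (init 3 2) := by
  cases d
  · refine .of_mirror (bounded_of_right (w := w) ?_)
    rw [mirror, hM]
    rfl
  · exact bounded_of_right hM

theorem bounded (M : Machine 3 2) : Bounded M 21 (init 3 2) := by
  rcases Tr.exists_value (M 0 0) with hnone | ⟨⟨w, d, _ | _ | _⟩, hM⟩
  · exact rep_init.bounded_of_halt hnone (by decide)
  · exact bounded_of_search (search_stay w d) (.single hM) rep_init
  · exact bounded_of_toB hM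
  · refine .of_swapStates (bounded_of_toB (w := w) (d := d) ?_)
    have h₀ : Equiv.swap (1 : Fin 3) 2 0 = 0 := by decide
    have h₂ : Equiv.swap (1 : Fin 3) 2 2 = 1 := by decide
    simp [swapStates, h₀, h₂, hM, Tr.value, St.fin]

/-! ### Attainment -/

theorem finite_nonblank_iterate_step (M : Machine 3 2) {c : Cfg 3 2}
    (hc : {i : ℤ | c.tape i ≠ 0}.Finite) (t : ℕ) :
    {i : ℤ | ((step M)^[t] c).tape i ≠ 0}.Finite := by
  induction t generalizing c with
  | zero => exact hc
  | succ t ih =>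
    rw [Function.iterate_succ_apply]
    refine ih ((hc.insert c.pos).subset fun i hi => ?_)
    by_cases hpos : i = c.pos
    · exact .inl hpos
    · refine .inr ?_
      unfold step at hi
      cases hs : c.state with
      | none => simpa [hs] using hi
      | some q => simpa [hs, Function.update_of_ne hpos] using hi

theorem finite_nonblank (M : Machine 3 2) (t : ℕ) :
    {i : ℤ | ((step M)^[t] (init 3 2)).tape i ≠ 0}.Finite :=
  finite_nonblank_iterate_step M (by simp [init]) t

/-- The machine `1RB1RH_0RC1RB_1LC1LA`, which leaves `6` nonblank cells after `14` steps. -/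
def sigmaChampion : Machine 3 2 :=
  ![![(1, .R, some 1), (1, .R, none)], ![(0, .R, some 2), (1, .R, some 1)],
    ![(1, .L, some 2), (1, .L, some 0)]]

/-- The machine `1RB1RH_1LB0RC_1LC1LA`, which halts after `21` steps. -/
def stepChampion : Machine 3 2 :=
  ![![(1, .R, some 1), (1, .R, none)], ![(1, .L, some 1), (0, .R, some 2)],
    ![(1, .L, some 2), (1, .L, some 0)]]

instance : DecidableEq Dir
  | .L, .L => isTrue rfl
  | .L, .R => isFalse nofun
  | .R, .L => isFalse nofun
  | .R, .R => isTrue rfl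

theorem valid_sigmaChampion : Valid sigmaChampion := by
  unfold Valid
  decide

theorem valid_stepChampion : Valid stepChampion := by
  unfold Valid
  decide

theorem haltsIn_sigmaChampion : HaltsIn sigmaChampion (init 3 2) 14 := by
  unfold HaltsIn
  decide +kernel

theorem haltsIn_stepChampion : HaltsIn stepChampion (init 3 2) 21 := by
  unfold HaltsIn
  decide +kernel

theorem nonblank_sigmaChampion :
    ∀ i ∈ Finset.Icc (-1 : ℤ) 4, ((step sigmaChampion)^[14] (init 3 2)).tape i ≠ 0 := by
  decide +kernel

theorem sigmaCount_sigmaChampion :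
    sigmaCount ((step sigmaChampion)^[14] (init 3 2)) = 6 := by
  refine le_antisymm (bounded _ _ haltsIn_sigmaChampion).2 ?_
  have h := Set.ncard_le_ncard (s := ↑(Finset.Icc (-1 : ℤ) 4))
    (fun i hi => nonblank_sigmaChampion i (Finset.mem_coe.1 hi))
    (finite_nonblank sigmaChampion 14)
  rwa [Set.ncard_coe_finset, Int.card_Icc] at h

end BusyBeaver

/-- Every 3-state 2-symbol machine that halts from the all-blank tape takes at most
21 steps and leaves at most 6 non-blank cells; both bounds are attained.
That is, `S(3,2) = 21` and `Σ(3,2) = 6`. -/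
theorem busy_beaver_values_3_2 :
    (∀ M : Machine 3 2, Valid M → ∀ t : ℕ, HaltsIn M (init 3 2) t →
        t ≤ 21 ∧ sigmaCount ((step M)^[t] (init 3 2)) ≤ 6) ∧
    (∃ M : Machine 3 2, Valid M ∧ HaltsIn M (init 3 2) 21) ∧
    (∃ M : Machine 3 2, Valid M ∧ ∃ t : ℕ, HaltsIn M (init 3 2) t ∧
        sigmaCount ((step M)^[t] (init 3 2)) = 6) ∧
    bbS 3 2 = 21 ∧ bbSigma 3 2 = 6 := by
  have hbound (M : Machine 3 2) (t : ℕ) (ht : HaltsIn M (init 3 2) t) := BusyBeaver.bounded M t ht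
  refine ⟨fun M _ => hbound M, ⟨_, BusyBeaver.valid_stepChampion, BusyBeaver.haltsIn_stepChampion⟩,
    ⟨_, BusyBeaver.valid_sigmaChampion, _, BusyBeaver.haltsIn_sigmaChampion,
      BusyBeaver.sigmaCount_sigmaChampion⟩, IsGreatest.csSup_eq ⟨?_, ?_⟩,
    IsGreatest.csSup_eq ⟨?_, ?_⟩⟩
  · exact ⟨_, BusyBeaver.valid_stepChampion, BusyBeaver.haltsIn_stepChampion⟩
  · rintro t ⟨M, -, ht⟩
    exact (hbound M t ht).1
  · exact ⟨_, BusyBeaver.valid_sigmaChampion, _, BusyBeaver.haltsIn_sigmaChampion,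
      BusyBeaver.sigmaCount_sigmaChampion⟩
  · rintro m ⟨M, -, t, ht, rfl⟩
    exact (hbound M t ht).2
end
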